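/- The set ∂T of extreme points of T is non-discriminatory (i.e., for all Borel probability measures π, π' on ∂T and every finite nonempty A ⊆ ℝ^Θ, equality of the induced skill distributions p_π = p_π' implies ∫ v_A dπ = ∫ v_A dπ') if and only if for every finite nonempty A ⊆ ℝ^Θ the function W_A is affine on T. -/

import Mathlib

open MeasureTheory Set

section Defs

variable {Θ : Type*} [Fintype Θ]

/-- The value function `v_A(s) = max_{a ∈ A} ∑_θ a(θ) s(θ)`. -/
noncomputable def valueFn (A : Set (Θ → ℝ)) (s : Θ → ℝ) : ℝ :=
  sSup ((fun a => ∑ θ, a θ * s θ) '' A)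

/-- A binary set: one or two elements. -/
def Binary (A : Set (Θ → ℝ)) : Prop := A.ncard = 1 ∨ A.ncard = 2

/-- An information structure on `S`: a Borel probability measure supported on `S`. -/
def IsInfoStructure (S : Set (Θ → ℝ)) (π : Measure (Θ → ℝ)) : Prop :=
  IsProbabilityMeasure π ∧ π Sᶜ = 0

/-- The skill distribution `p_π(θ) = ∫_S s(θ) dπ(s)` induced by `π`. -/
noncomputable def skillDist (S : Set (Θ → ℝ)) (π : Measure (Θ → ℝ)) : Θ → ℝ :=
  fun θ => ∫ s in S, s θ ∂π

/-- `S` is non-discriminatory. -/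
def NonDiscriminatory (S : Set (Θ → ℝ)) : Prop :=
  ∀ π π' : Measure (Θ → ℝ), IsInfoStructure S π → IsInfoStructure S π' →
    ∀ A : Set (Θ → ℝ), A.Finite → A.Nonempty →
      skillDist S π = skillDist S π' →
      ∫ t in S, valueFn A t ∂π = ∫ t in S, valueFn A t ∂π'

/-- `S` is non-discriminatory for binary sets. -/
def NonDiscriminatoryBinary (S : Set (Θ → ℝ)) : Prop :=
  ∀ π π' : Measure (Θ → ℝ), IsInfoStructure S π → IsInfoStructure S π' →
    ∀ A : Set (Θ → ℝ), Binary A →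
      skillDist S π = skillDist S π' →
      ∫ t in S, valueFn A t ∂π = ∫ t in S, valueFn A t ∂π'

/-- `S` is identified. -/
def Identified (S : Set (Θ → ℝ)) : Prop :=
  ∀ π π' : Measure (Θ → ℝ), IsInfoStructure S π → IsInfoStructure S π' →
    skillDist S π = skillDist S π' → π = π'

/-- `S` admits fair valuations. -/
def FairValuations (S : Set (Θ → ℝ)) : Prop :=
  ∀ A : Set (Θ → ℝ), A.Finite → A.Nonempty →
    ∃ α : Θ → ℝ, ∀ t ∈ S, valueFn A t = ∑ θ, α θ * t θ

/-- `S` admits fair valuations for binary sets. -/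
def FairValuationsBinary (S : Set (Θ → ℝ)) : Prop :=
  ∀ A : Set (Θ → ℝ), Binary A →
    ∃ α : Θ → ℝ, ∀ t ∈ S, valueFn A t = ∑ θ, α θ * t θ

/-- `W_A(p)`: value of optimal information design with skill distribution `p`,
over information structures on `S`. -/
noncomputable def Wfn (A S : Set (Θ → ℝ)) (p : Θ → ℝ) : ℝ :=
  sSup {x | ∃ π : Measure (Θ → ℝ), IsInfoStructure S π ∧ skillDist S π = p ∧
    x = ∫ t in S, valueFn A t ∂π}

/-- A function is affine on `T`. -/
def AffineOnSet (W : (Θ → ℝ) → ℝ) (T : Set (Θ → ℝ)) : Prop :=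
  ∀ p ∈ T, ∀ q ∈ T, ∀ γ : ℝ, 0 ≤ γ → γ ≤ 1 →
    W (γ • p + (1 - γ) • q) = γ * W p + (1 - γ) * W q

end Defs

section Compactness

variable {E : Type*} [AddCommGroup E] [Module ℝ E] [FiniteDimensional ℝ E]

theorem convexHull_eq_biUnion_stdSimplex (K : Set E) :
    convexHull ℝ K = ⋃ m ∈ Set.Iic (Module.finrank ℝ E + 1),
      (fun x : (Fin m → ℝ) × (Fin m → E) => ∑ i, x.1 i • x.2 i) ''
        (stdSimplex ℝ (Fin m) ×ˢ Set.univ.pi fun _ => K) := by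
  ext x
  simp only [Set.mem_iUnion, Set.mem_image, Set.mem_prod, Set.mem_pi, Set.mem_univ,
    true_implies, exists_prop, Set.mem_Iic, Prod.exists]
  constructor
  · intro hx
    obtain ⟨ι, _, z, w, hz, hind, hw, hw1, rfl⟩ := eq_pos_convex_span_of_mem_convexHull hx
    let e := (Fintype.equivFin ι).symm
    refine ⟨Fintype.card ι, ?_, w ∘ e, z ∘ e, ⟨⟨fun i => (hw _).le, ?_⟩, fun i => hz ⟨_, rfl⟩⟩, ?_⟩
    · exact hind.card_le_finrank_succ.trans
        (Nat.add_le_add_right (Submodule.finrank_le _) 1)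
    · rw [← hw1]
      exact e.sum_comp w
    · exact e.sum_comp fun i => w i • z i
  · rintro ⟨m, -, w, z, ⟨hw, hz⟩, rfl⟩
    exact mem_convexHull_of_exists_fintype w z hw.1 hw.2 hz rfl

theorem IsCompact.convexHull_of_finiteDimensional [TopologicalSpace E] [ContinuousAdd E]
    [ContinuousSMul ℝ E] {K : Set E} (hK : IsCompact K) : IsCompact (convexHull ℝ K) := by
  rw [convexHull_eq_biUnion_stdSimplex]
  refine (Set.finite_Iic _).isCompact_biUnion fun m _ => ?_
  exact ((isCompact_stdSimplex ℝ (Fin m)).prod (isCompact_univ_pi fun _ => hK)).image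
    (by fun_prop)

end Compactness

theorem exists_linearMap_of_sum_smul_eq_zero {E : Type*} [AddCommGroup E] [Module ℝ E]
    {S : Set E} {f : E → ℝ}
    (h : ∀ (s : Finset S) (c : S → ℝ), ∑ i ∈ s, c i • (i : E) = 0 → ∑ i ∈ s, c i * f i = 0) :
    ∃ l : E →ₗ[ℝ] ℝ, ∀ t ∈ S, f t = l t := by
  let L := Finsupp.linearCombination ℝ (Subtype.val : S → E)
  let F := Finsupp.linearCombination ℝ (fun t : S => f t)
  have hF : F ∈ (LinearMap.ker L).dualAnnihilator := by
    rw [Submodule.mem_dualAnnihilator]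
    intro c hc
    exact h c.support c hc
  rw [← LinearMap.range_dualMap_eq_dualAnnihilator_ker] at hF
  obtain ⟨l, hl⟩ := hF
  refine ⟨l, fun t ht => ?_⟩
  have := LinearMap.congr_fun hl (Finsupp.single ⟨t, ht⟩ 1)
  simpa [L, F] using this.symm

section Linearization

variable {Θ : Type*} [Fintype Θ]

theorem exists_linearMap_of_weights {S : Set (Θ → ℝ)} (hS : S ⊆ stdSimplex ℝ Θ)
    {f : (Θ → ℝ) → ℝ}
    (h : ∀ (s : Finset S) (w w' : S → ℝ), (∀ i, 0 ≤ w i) → (∀ i, 0 ≤ w' i) →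
      ∑ i ∈ s, w i = 1 → ∑ i ∈ s, w' i = 1 →
      ∑ i ∈ s, w i • (i : Θ → ℝ) = ∑ i ∈ s, w' i • (i : Θ → ℝ) →
      ∑ i ∈ s, w i * f i = ∑ i ∈ s, w' i * f i) :
    ∃ l : (Θ → ℝ) →ₗ[ℝ] ℝ, ∀ t ∈ S, f t = l t := by
  refine exists_linearMap_of_sum_smul_eq_zero fun s c hc => ?_
  have hsplit : ∀ i, c i = (c i)⁺ - (c i)⁻ := fun i => (posPart_sub_negPart (c i)).symm
  have hsum : ∑ i ∈ s, c i = 0 := by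
    have := congrArg (fun v : Θ → ℝ => ∑ θ, v θ) hc
    simp only [Finset.sum_apply, Pi.smul_apply, smul_eq_mul, Pi.zero_apply,
      Finset.sum_const_zero] at this
    rw [Finset.sum_comm] at this
    simpa [← Finset.mul_sum, (hS (Subtype.prop _)).2] using this
  have hPN : ∑ i ∈ s, (c i)⁺ = ∑ i ∈ s, (c i)⁻ := by
    rw [← sub_eq_zero, ← Finset.sum_sub_distrib, ← hsum]
    exact Finset.sum_congr rfl fun i _ => (hsplit i).symm
  set P := ∑ i ∈ s, (c i)⁺ with hP
  rcases (Finset.sum_nonneg fun i _ => posPart_nonneg (c i) : 0 ≤ P).eq_or_lt with h0 | h0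
  · have h1 := (Finset.sum_eq_zero_iff_of_nonneg fun i _ => posPart_nonneg (c i)).1 (hP ▸ h0.symm)
    have h2 := (Finset.sum_eq_zero_iff_of_nonneg fun i _ => negPart_nonneg (c i)).1
      (hPN.symm.trans h0.symm)
    exact Finset.sum_eq_zero fun i hi => by rw [hsplit i, h1 i hi, h2 i hi]; simp
  · have key := h s (fun i => P⁻¹ * (c i)⁺) (fun i => P⁻¹ * (c i)⁻)
      (fun i => mul_nonneg (inv_nonneg.2 h0.le) (posPart_nonneg _))
      (fun i => mul_nonneg (inv_nonneg.2 h0.le) (negPart_nonneg _))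
      (by rw [← Finset.mul_sum, inv_mul_cancel₀ h0.ne'])
      (by rw [← Finset.mul_sum, ← hPN, inv_mul_cancel₀ h0.ne'])
      (by
        simp only [mul_smul, ← Finset.smul_sum]
        congr 1
        rw [← sub_eq_zero, ← Finset.sum_sub_distrib, ← hc]
        exact Finset.sum_congr rfl fun i _ => by rw [← sub_smul, ← hsplit])
    simp only [mul_assoc, ← Finset.mul_sum] at key
    have key' := mul_left_cancel₀ (inv_ne_zero h0.ne') key
    rw [← sub_eq_zero, ← Finset.sum_sub_distrib] at key'
    rw [← key']
    exact Finset.sum_congr rfl fun i _ => by rw [← sub_mul, ← hsplit]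

end Linearization

section ValueFunction

variable {Θ : Type*} [Fintype Θ] {A : Set (Θ → ℝ)}

theorem continuous_valueFn (hA : A.Finite) (hne : A.Nonempty) : Continuous (valueFn A) := by
  have hne' : hA.toFinset.Nonempty := by simpa using hne
  have : valueFn A = fun s => hA.toFinset.sup' hne' fun a => ∑ θ, a θ * s θ := by
    ext s
    rw [Finset.sup'_eq_csSup_image, hA.coe_toFinset, valueFn]
  rw [this]
  exact Continuous.finset_sup'_apply hne' fun a _ => by fun_prop

theorem valueFn_le_iff (hA : A.Finite) (hne : A.Nonempty) {s : Θ → ℝ} {c : ℝ} :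
    valueFn A s ≤ c ↔ ∀ a ∈ A, ∑ θ, a θ * s θ ≤ c := by
  rw [valueFn, csSup_le_iff (hA.image _).bddAbove (hne.image _)]
  simp

end ValueFunction

section InfoStructure

variable {Θ : Type*} {S : Set (Θ → ℝ)} {π : Measure (Θ → ℝ)}

theorem IsInfoStructure.ae_mem (h : IsInfoStructure S π) : ∀ᵐ s ∂π, s ∈ S :=
  mem_ae_iff.2 h.2

theorem IsInfoStructure.restrict_eq (h : IsInfoStructure S π) : π.restrict S = π :=
  Measure.restrict_eq_self_of_ae_mem h.ae_mem

variable [Fintype Θ]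

theorem IsInfoStructure.integrable {F : Type*} [NormedAddCommGroup F] (h : IsInfoStructure S π)
    (hS : S ⊆ stdSimplex ℝ Θ) {f : (Θ → ℝ) → F} (hf : Continuous f)
    [SecondCountableTopologyEither (Θ → ℝ) F] : Integrable f π := by
  have := h.1
  obtain ⟨C, hC⟩ := (isCompact_stdSimplex ℝ Θ).exists_bound_of_continuousOn hf.continuousOn
  exact Integrable.of_bound hf.aestronglyMeasurable C
    (h.ae_mem.mono fun s hs => hC s (hS hs))

theorem IsInfoStructure.skillDist_eq (h : IsInfoStructure S π) (hS : S ⊆ stdSimplex ℝ Θ) :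
    skillDist S π = ∫ s, s ∂π := by
  ext θ
  rw [skillDist, h.restrict_eq]
  exact (ContinuousLinearMap.proj (R := ℝ) (φ := fun _ : Θ => ℝ) θ).integral_comp_comm
    (h.integrable hS continuous_id)

theorem IsInfoStructure.integral_linearMap (h : IsInfoStructure S π) (hS : S ⊆ stdSimplex ℝ Θ)
    (l : (Θ → ℝ) →ₗ[ℝ] ℝ) : ∫ s, l s ∂π = l (skillDist S π) := by
  rw [h.skillDist_eq hS]
  exact l.toContinuousLinearMap.integral_comp_comm (h.integrable hS continuous_id)

theorem exists_infoStructure_of_weights {ι : Type*} (s : Finset ι) (w : ι → ℝ)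
    (z : ι → Θ → ℝ) (hw : ∀ i ∈ s, 0 ≤ w i) (hw1 : ∑ i ∈ s, w i = 1)
    (hz : ∀ i ∈ s, z i ∈ S) :
    ∃ π : Measure (Θ → ℝ), IsInfoStructure S π ∧ skillDist S π = ∑ i ∈ s, w i • z i ∧
      ∀ f : (Θ → ℝ) → ℝ, ∫ t in S, f t ∂π = ∑ i ∈ s, w i * f (z i) := by
  let π : Measure (Θ → ℝ) := ∑ i ∈ s, ENNReal.ofReal (w i) • Measure.dirac (z i)
  have hπ : IsInfoStructure S π := by
    refine ⟨⟨?_⟩, ?_⟩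
    · simp only [π, Measure.coe_finsetSum, Finset.sum_apply, Measure.smul_apply, measure_univ,
        smul_eq_mul, mul_one]
      rw [← ENNReal.ofReal_sum_of_nonneg hw, hw1, ENNReal.ofReal_one]
    · simp only [π, Measure.coe_finsetSum, Finset.sum_apply, Measure.smul_apply, smul_eq_mul]
      exact Finset.sum_eq_zero fun i hi => by simp [hz i hi]
  have hint (f : (Θ → ℝ) → ℝ) : ∫ t in S, f t ∂π = ∑ i ∈ s, w i * f (z i) := by
    rw [hπ.restrict_eq, integral_finsetSum_measure fun i _ =>
      (integrable_dirac (by simp)).smul_measure (by simp)]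
    exact Finset.sum_congr rfl fun i hi => by
      rw [integral_smul_measure, integral_dirac, ENNReal.toReal_ofReal (hw i hi), smul_eq_mul]
  refine ⟨π, hπ, ?_, hint⟩
  ext θ
  simpa [skillDist] using hint fun t => t θ

/-- A probability measure on a compact convex set whose barycenter is an extreme point is
concentrated at that point. -/
theorem IsInfoStructure.ae_eq_of_mem_extremePoints (hS : S ⊆ stdSimplex ℝ Θ) (hconv : Convex ℝ S)
    (hclosed : IsClosed S) (h : IsInfoStructure S π) (hext : skillDist S π ∈ S.extremePoints ℝ) :
    ∀ᵐ s ∂π, s = skillDist S π := by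
  have := h.1
  have hint : Integrable (fun s : Θ → ℝ => s) π := h.integrable hS continuous_id
  have hmem : ∀ᵐ s ∂π, s ∈ S := h.ae_mem
  rw [h.skillDist_eq hS, ← average_eq_integral] at *
  rcases ae_eq_const_or_exists_average_ne_compl hint with h1 | ⟨t, ht, h0, h0', hne⟩
  · exact h1
  · have hseg := average_mem_openSegment_compl_self ht.nullMeasurableSet h0 h0' hint
    have hx := hconv.set_average_mem hclosed h0 (measure_ne_top _ _)
      (ae_restrict_of_ae hmem) hint.integrableOn
    have hy := hconv.set_average_mem hclosed h0' (measure_ne_top _ _)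
      (ae_restrict_of_ae hmem) hint.integrableOn
    obtain ⟨e1, e2⟩ := (mem_extremePoints.1 hext).2 _ hx _ hy hseg
    exact absurd (e1.trans e2.symm) hne

theorem Wfn_eq_valueFn_of_mem_extremePoints {A : Set (Θ → ℝ)} (hS : S ⊆ stdSimplex ℝ Θ)
    (hconv : Convex ℝ S) (hclosed : IsClosed S) {t : Θ → ℝ} (ht : t ∈ S.extremePoints ℝ) :
    Wfn A S t = valueFn A t := by
  rw [Wfn, ← csSup_singleton (valueFn A t)]
  congr 1
  ext x
  constructor
  · rintro ⟨π, hπ, rfl, rfl⟩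
    have := hπ.1
    have hae := hπ.ae_eq_of_mem_extremePoints hS hconv hclosed ht
    rw [hπ.restrict_eq, integral_congr_ae (g := fun _ => valueFn A (skillDist S π))
      (hae.mono fun s hs => congrArg (valueFn A) hs)]
    simp
  · rintro rfl
    obtain ⟨π, hπ, hp, hf⟩ := exists_infoStructure_of_weights {()} (fun _ => (1 : ℝ))
      (fun _ => t) (by simp) (by simp) (fun _ _ => extremePoints_subset ht)
    exact ⟨π, hπ, by simpa using hp, by simpa using (hf (valueFn A)).symm⟩

end InfoStructure

section FairValuations

variable {Θ : Type*} {S T : Set (Θ → ℝ)} {A : Set (Θ → ℝ)}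

theorem AffineOnSet.map_sum {W : (Θ → ℝ) → ℝ} (hW : AffineOnSet W T) (hT : Convex ℝ T)
    {ι : Type*} (s : Finset ι) (w : ι → ℝ) (z : ι → Θ → ℝ) (hw : ∀ i ∈ s, 0 ≤ w i)
    (hw1 : ∑ i ∈ s, w i = 1) (hz : ∀ i ∈ s, z i ∈ T) :
    W (∑ i ∈ s, w i • z i) = ∑ i ∈ s, w i * W (z i) := by
  have key : ∀ ⦃x⦄, x ∈ T → ∀ ⦃y⦄, y ∈ T → ∀ ⦃a b : ℝ⦄, 0 ≤ a → 0 ≤ b → a + b = 1 →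
      W (a • x + b • y) = a • W x + b • W y := by
    intro x hx y hy a b ha hb hab
    obtain rfl : b = 1 - a := by linarith
    exact hW x hx y hy a ha (by linarith)
  exact le_antisymm
    (ConvexOn.map_sum_le ⟨hT, fun x hx y hy a b ha hb hab => (key hx hy ha hb hab).le⟩ hw hw1 hz)
    (ConcaveOn.le_map_sum ⟨hT, fun x hx y hy a b ha hb hab => (key hx hy ha hb hab).ge⟩ hw hw1 hz)

variable [Fintype Θ]

theorem NonDiscriminatory.exists_linearMap (h : NonDiscriminatory S) (hS : S ⊆ stdSimplex ℝ Θ)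
    (hA : A.Finite) (hne : A.Nonempty) :
    ∃ l : (Θ → ℝ) →ₗ[ℝ] ℝ, ∀ t ∈ S, valueFn A t = l t := by
  refine exists_linearMap_of_weights hS fun s w w' hw hw' h1 h1' heq => ?_
  obtain ⟨π, hπ, hp, hf⟩ := exists_infoStructure_of_weights s w Subtype.val
    (fun i _ => hw i) h1 (fun i _ => i.2)
  obtain ⟨π', hπ', hp', hf'⟩ := exists_infoStructure_of_weights s w' Subtype.val
    (fun i _ => hw' i) h1' (fun i _ => i.2)
  rw [← hf, ← hf']
  exact h π π' hπ hπ' A hA hne (by rw [hp, hp', heq])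

theorem nonDiscriminatory_of_exists_linearMap (hS : S ⊆ stdSimplex ℝ Θ)
    (h : ∀ A : Set (Θ → ℝ), A.Finite → A.Nonempty →
      ∃ l : (Θ → ℝ) →ₗ[ℝ] ℝ, ∀ t ∈ S, valueFn A t = l t) : NonDiscriminatory S := by
  intro π π' hπ hπ' A hA hne heq
  obtain ⟨l, hl⟩ := h A hA hne
  have key {ρ : Measure (Θ → ℝ)} (hρ : IsInfoStructure S ρ) :
      ∫ t in S, valueFn A t ∂ρ = l (skillDist S ρ) := by
    rw [hρ.restrict_eq, ← hρ.integral_linearMap hS]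
    exact integral_congr_ae (hρ.ae_mem.mono hl)
  rw [key hπ, key hπ', heq]

/-- If the value function agrees with a linear form on the extreme points of a compact convex set,
then the optimal value is given by that linear form. -/
theorem Wfn_eq_linearMap (hT : T ⊆ stdSimplex ℝ Θ) (hconv : Convex ℝ T) (hcomp : IsCompact T)
    (hA : A.Finite) (hne : A.Nonempty) {l : (Θ → ℝ) →ₗ[ℝ] ℝ}
    (hl : ∀ t ∈ T.extremePoints ℝ, valueFn A t = l t) {p : Θ → ℝ} (hp : p ∈ T) :
    Wfn A T p = l p := by
  have hlc : Continuous l := l.continuous_of_finiteDimensional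
  have hv := continuous_valueFn hA hne
  have hKM := closure_convexHull_extremePoints hcomp hconv
  have hsub : closure (T.extremePoints ℝ) ⊆ T :=
    closure_minimal extremePoints_subset hcomp.isClosed
  have heq : ∀ t ∈ closure (T.extremePoints ℝ), valueFn A t = l t :=
    fun t ht => closure_minimal (s := T.extremePoints ℝ) (t := {t | valueFn A t = l t}) hl
      (isClosed_eq hv hlc) ht
  have hhull : p ∈ convexHull ℝ (closure (T.extremePoints ℝ)) := by
    have hc := (hcomp.of_isClosed_subset isClosed_closure hsub).convexHull_of_finiteDimensional
    rw [← hKM] at hp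
    exact closure_minimal (convexHull_mono subset_closure) hc.isClosed hp
  have hle : ∀ t ∈ T, valueFn A t ≤ l t := by
    have hcl : IsClosed {t | valueFn A t ≤ l t} := isClosed_le hv hlc
    have hcv : Convex ℝ {t | valueFn A t ≤ l t} := by
      intro x hx y hy a b ha hb hab
      simp only [Set.mem_ofPred_eq, valueFn_le_iff hA hne] at hx hy ⊢
      intro c hc
      have := add_le_add (mul_le_mul_of_nonneg_left (hx c hc) ha)
        (mul_le_mul_of_nonneg_left (hy c hc) hb)
      simp only [map_add, map_smul, smul_eq_mul]
      refine le_of_eq_of_le ?_ this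
      simp only [Finset.mul_sum, ← Finset.sum_add_distrib, Pi.add_apply, Pi.smul_apply,
        smul_eq_mul]
      exact Finset.sum_congr rfl fun θ _ => by ring
    intro t ht
    rw [← hKM] at ht
    exact closure_minimal (convexHull_min (fun t ht => (hl t ht).le) hcv) hcl ht
  refine IsGreatest.csSup_eq ⟨?_, ?_⟩
  · rw [convexHull_eq] at hhull
    obtain ⟨ι, s, w, z, hw, hw1, hz, rfl⟩ := hhull
    obtain ⟨π, hπ, hb, hf⟩ := exists_infoStructure_of_weights s w z hw hw1
      (fun i hi => hsub (hz i hi))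
    rw [Finset.centerMass_eq_of_sum_1 _ _ hw1]
    refine ⟨π, hπ, hb, ?_⟩
    rw [hf, map_sum]
    exact Finset.sum_congr rfl fun i hi => by rw [map_smul, heq _ (hz i hi), smul_eq_mul]
  · rintro x ⟨π, hπ, rfl, rfl⟩
    rw [hπ.restrict_eq, ← hπ.integral_linearMap hT]
    exact integral_mono_ae (hπ.integrable hT hv) (hπ.integrable hT hlc)
      (hπ.ae_mem.mono hle)

end FairValuations

variable {Θ : Type*} [Fintype Θ] [Nonempty Θ]

theorem stmt9 (𝒯 : Set (Θ → ℝ)) (h𝒯 : 𝒯 ⊆ stdSimplex ℝ Θ) (h𝒯c : IsClosed 𝒯) :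
    NonDiscriminatory (Set.extremePoints ℝ (closure (convexHull ℝ 𝒯))) ↔
      ∀ A : Set (Θ → ℝ), A.Finite → A.Nonempty →
        AffineOnSet (Wfn A (closure (convexHull ℝ 𝒯))) (closure (convexHull ℝ 𝒯)) := by
  have hT : closure (convexHull ℝ 𝒯) ⊆ stdSimplex ℝ Θ :=
    closure_minimal (convexHull_min h𝒯 (convex_stdSimplex ℝ Θ)) (isClosed_stdSimplex ℝ Θ)
  have hconv : Convex ℝ (closure (convexHull ℝ 𝒯)) := (convex_convexHull ℝ 𝒯).closure
  have hcomp : IsCompact (closure (convexHull ℝ 𝒯)) :=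
    (isCompact_stdSimplex ℝ Θ).of_isClosed_subset isClosed_closure hT
  generalize closure (convexHull ℝ 𝒯) = T at hT hconv hcomp
  have hE : T.extremePoints ℝ ⊆ stdSimplex ℝ Θ := extremePoints_subset.trans hT
  constructor
  · intro h A hA hne p hp q hq γ h0 h1
    obtain ⟨l, hl⟩ := h.exists_linearMap hE hA hne
    have hW {p : Θ → ℝ} (hp : p ∈ T) := Wfn_eq_linearMap hT hconv hcomp hA hne hl hp
    rw [hW hp, hW hq, hW (hconv hp hq h0 (sub_nonneg.2 h1) (add_sub_cancel _ _)), map_add,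
      map_smul, map_smul, smul_eq_mul, smul_eq_mul]
  · intro h
    refine nonDiscriminatory_of_exists_linearMap hE fun A hA hne =>
      exists_linearMap_of_weights hE fun s w w' hw hw' h1 h1' heq => ?_
    have hWv (t : T.extremePoints ℝ) : valueFn A t = Wfn A T t :=
      (Wfn_eq_valueFn_of_mem_extremePoints hT hconv hcomp.isClosed t.2).symm
    have hmem : ∀ i ∈ s, (i : Θ → ℝ) ∈ T := fun i _ => extremePoints_subset i.2
    simp only [hWv]
    rw [← (h A hA hne).map_sum hconv s w Subtype.val (fun i _ => hw i) h1 hmem,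
      ← (h A hA hne).map_sum hconv s w' Subtype.val (fun i _ => hw' i) h1' hmem, heq]
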